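/- Let F be a field, n = k+1, and let G = (I_k | a) be the k×(k+1) matrix whose last column is a = (a_1,…,a_k)ᵀ ∈ F^k. Then G is not an LCED matrix if and only if (n : F) = 0 (i.e., the characteristic of F divides n = k+1) and a_i = −1 for all i = 1,…,k. -/

import Mathlib

open Matrix

/-- The permutation matrix of `σ`: the `(i, j)` entry is `1` if `σ j = i` and `0` otherwise. -/
def permMat (F : Type*) [Zero F] [One F] {n : Type*} [DecidableEq n]
    (σ : Equiv.Perm n) : Matrix n n F :=
  Matrix.of fun i j => if σ j = i then 1 else 0

/-- A matrix `G` over a field is an LCED matrix if there is a permutation matrix `P`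
such that `G * P * Gᵀ` is invertible. -/
def IsLCEDMatrix {F : Type*} [Field F] {k n : Type*} [Fintype k] [Fintype n]
    [DecidableEq k] [DecidableEq n] (G : Matrix k n F) : Prop :=
  ∃ σ : Equiv.Perm n, IsUnit (G * permMat F σ * Gᵀ)

/-- The `k × (k+1)` matrix `(I_k | a)` whose first `k` columns form the identity matrix
and whose last column is the vector `a`. -/
def stdMat {F : Type*} [Zero F] [One F] {k : ℕ} (a : Fin k → F) :
    Matrix (Fin k) (Fin (k + 1)) F :=
  Matrix.of fun s j => if (j : ℕ) = (s : ℕ) then 1 else if (j : ℕ) = k then a s else 0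

theorem permMat_mulVec {F : Type*} [Field F] {n : Type*} [Fintype n] [DecidableEq n]
    (σ : Equiv.Perm n) (v : n → F) : permMat F σ *ᵥ v = fun i => v (σ.symm i) := by
  ext i
  simp only [Matrix.mulVec, dotProduct, permMat, Matrix.of_apply]
  rw [Finset.sum_eq_single (σ.symm i)]
  · simp
  · intro b _ hb
    have : σ b ≠ i := fun h => hb (by simp [← h])
    simp [this]
  · simp

theorem stdMat_castSucc {F : Type*} [Field F] {k : ℕ} (a : Fin k → F) (s j : Fin k) :
    stdMat a s j.castSucc = if j = s then 1 else 0 := by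
  have := j.isLt.ne
  simp [stdMat, this, Fin.ext_iff]

theorem stdMat_last {F : Type*} [Field F] {k : ℕ} (a : Fin k → F) (s : Fin k) :
    stdMat a s (Fin.last k) = a s := by
  have := s.isLt.ne'
  simp [stdMat, this]

theorem stdMat_mulVec {F : Type*} [Field F] {k : ℕ} (a : Fin k → F) (w : Fin (k + 1) → F)
    (s : Fin k) : (stdMat a *ᵥ w) s = w s.castSucc + a s * w (Fin.last k) := by
  simp [Matrix.mulVec, dotProduct, Fin.sum_univ_castSucc, stdMat_castSucc, stdMat_last]

theorem stdMat_transpose_mulVec_castSucc {F : Type*} [Field F] {k : ℕ} (a : Fin k → F)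
    (x : Fin k → F) (j : Fin k) : ((stdMat a)ᵀ *ᵥ x) j.castSucc = x j := by
  simp [Matrix.mulVec, dotProduct, stdMat_castSucc]

theorem stdMat_transpose_mulVec_last {F : Type*} [Field F] {k : ℕ} (a : Fin k → F)
    (x : Fin k → F) : ((stdMat a)ᵀ *ᵥ x) (Fin.last k) = ∑ s, a s * x s := by
  simp [Matrix.mulVec, dotProduct, stdMat_last]

/-- The generator of the kernel of `(I_k | a)`. -/
def kerVec {F : Type*} [Field F] {k : ℕ} (a : Fin k → F) : Fin (k + 1) → F :=
  Fin.snoc (α := fun _ => F) a (-1)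

theorem kerVec_castSucc {F : Type*} [Field F] {k : ℕ} (a : Fin k → F) (j : Fin k) :
    kerVec a j.castSucc = a j := by simp [kerVec]

theorem kerVec_last {F : Type*} [Field F] {k : ℕ} (a : Fin k → F) :
    kerVec a (Fin.last k) = -1 := by simp [kerVec]

theorem isUnit_iff_sum {F : Type*} [Field F] {k : ℕ} (a : Fin k → F)
    (σ : Equiv.Perm (Fin (k + 1))) :
    IsUnit (stdMat a * permMat F σ * (stdMat a)ᵀ) ↔
      ∑ i, kerVec a (σ i) * kerVec a i ≠ 0 := by
  have hM : ∀ x, (stdMat a * permMat F σ * (stdMat a)ᵀ) *ᵥ x =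
      stdMat a *ᵥ (fun i => ((stdMat a)ᵀ *ᵥ x) (σ.symm i)) := by
    intro x
    rw [← Matrix.mulVec_mulVec, ← Matrix.mulVec_mulVec, permMat_mulVec]
  rw [← Matrix.mulVec_injective_iff_isUnit]
  constructor
  · intro hinj h0
    have hx : (stdMat a)ᵀ *ᵥ (fun j : Fin k => kerVec a (σ j.castSucc)) =
        fun i => kerVec a (σ i) := by
      funext i
      refine Fin.lastCases ?_ (fun j => ?_) i
      · rw [stdMat_transpose_mulVec_last]
        rw [Fin.sum_univ_castSucc] at h0
        simp only [kerVec_castSucc, kerVec_last] at h0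
        simp only [mul_comm (a _)]
        linear_combination h0
      · rw [stdMat_transpose_mulVec_castSucc]
    have hz : (fun j : Fin k => kerVec a (σ j.castSucc)) = 0 := by
      apply hinj
      rw [hM, hx, Matrix.mulVec_zero]
      funext s
      rw [stdMat_mulVec]
      simp [kerVec_castSucc, kerVec_last]
    rw [hz, Matrix.mulVec_zero] at hx
    have := congrFun hx (σ.symm (Fin.last k))
    simp [kerVec_last] at this
  · intro hne
    have : Function.Injective (Matrix.mulVecLin (stdMat a * permMat F σ * (stdMat a)ᵀ)) := by
      rw [injective_iff_map_eq_zero]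
      intro x hx
      rw [Matrix.mulVecLin_apply, hM] at hx
      set y := (stdMat a)ᵀ *ᵥ x with hy
      set c := y (σ.symm (Fin.last k)) with hc
      have hw : ∀ i, y (σ.symm i) = -c * kerVec a i := by
        intro i
        refine Fin.lastCases ?_ (fun j => ?_) i
        · simp [kerVec_last, hc]
        · have := congrFun hx j
          rw [stdMat_mulVec] at this
          rw [kerVec_castSucc]
          simp only [Pi.zero_apply, ← hc] at this
          linear_combination this
      have hw2 : ∀ i, y i = -c * kerVec a (σ i) := fun i => by simpa using hw (σ i)
      have hdot : ∑ i, y i * kerVec a i = 0 := by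
        rw [Fin.sum_univ_castSucc, hy]
        simp [stdMat_transpose_mulVec_castSucc, stdMat_transpose_mulVec_last, kerVec_castSucc,
          kerVec_last, mul_comm]
      have hcz : c = 0 := by
        simp only [hw2, mul_assoc] at hdot
        rw [← Finset.mul_sum] at hdot
        simpa [hne] using hdot
      funext j
      rw [← stdMat_transpose_mulVec_castSucc a x j, ← hy, hw2, hcz]
      simp
    exact this

/-- `G = (I_k | a)` is not an LCED matrix iff the characteristic of `F`
divides `n = k + 1` and every `a_i = -1`. -/
theorem stmt8 {F : Type*} [Field F] {k : ℕ} (a : Fin k → F) :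
    ¬ IsLCEDMatrix (stdMat a) ↔ ((k + 1 : ℕ) : F) = 0 ∧ ∀ i, a i = -1 := by
  constructor
  · intro hn
    have h0 : ∀ σ : Equiv.Perm (Fin (k + 1)), ∑ i, kerVec a (σ i) * kerVec a i = 0 := by
      intro σ
      by_contra h
      exact hn ⟨σ, (isUnit_iff_sum a σ).2 h⟩
    have ha : ∀ i, a i = -1 := by
      intro i
      have hne : i.castSucc ≠ Fin.last k := Fin.castSucc_ne_last i
      have h1 := h0 1
      have h2 := h0 (Equiv.swap i.castSucc (Fin.last k))
      have h3 : ∑ j, (kerVec a ((1 : Equiv.Perm (Fin (k + 1))) j) * kerVec a j -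
          kerVec a (Equiv.swap i.castSucc (Fin.last k) j) * kerVec a j) = 0 := by
        rw [Finset.sum_sub_distrib, h1, h2, sub_zero]
      rw [Fintype.sum_eq_add i.castSucc (Fin.last k) hne] at h3
      · simp only [Equiv.Perm.one_apply, Equiv.swap_apply_left, Equiv.swap_apply_right,
          kerVec_castSucc, kerVec_last] at h3
        have : (a i + 1) ^ 2 = 0 := by linear_combination h3
        have := pow_eq_zero_iff (two_ne_zero) |>.1 this
        linear_combination this
      · rintro j ⟨hj1, hj2⟩
        rw [Equiv.swap_apply_of_ne_of_ne hj1 hj2]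
        simp
    refine ⟨?_, ha⟩
    have h1 := h0 1
    rw [Fin.sum_univ_castSucc] at h1
    simpa [kerVec_castSucc, kerVec_last, ha] using h1
  · rintro ⟨hk, ha⟩ ⟨σ, hσ⟩
    refine (isUnit_iff_sum a σ).1 hσ ?_
    have hv : ∀ i, kerVec a i = -1 := fun i =>
      Fin.lastCases (kerVec_last a) (fun j => (kerVec_castSucc a j).trans (ha j)) i
    simpa [hv] using hk
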